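/- Let γ, π ∈ ℤ[i] with γ ≡ π ≡ 1 (mod λ³), π prime, π ∤ γ, δ ∈ λ^{-2}ℤ[i] with gcd(δ, π)=1, v ≡ 1 (mod λ³), and Re(s) > 3/2. With ψ_α(r, s; v) := Σ_{c ≡ v (mod 4), gcd(c,α)=1} g₄(r,c)/N(c)^s, one has ψ_γ(δπ, s; v) = (1 + g₂(δ, π)·N(π)^{1-2s}) · ψ_{γπ}(δπ, s; v). -/

import Mathlib

noncomputable section

open scoped Classical
open Complex

abbrev Zi := GaussianInt

def lam : Zi := ⟨1, 1⟩

def Ni (x : Zi) : ℤ := Zsqrtd.norm x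

/-- ě(z) = e^{2πi (z + z̄)} -/
def eCheck (z : ℂ) : ℂ := Complex.exp (2 * Real.pi * Complex.I * (z + (starRingEnd ℂ) z))

/-- Quartic residue symbol at a prime modulus: the unique fourth root of unity
congruent to `α ^ ((N π - 1)/4)` modulo `π`. -/
def quarticPrime (α π : Zi) : Zi :=
  if h : ∃ u : Zi, u ^ 4 = 1 ∧ π ∣ α ^ ((Ni π - 1) / 4).toNat - u then h.choose else 0

/-- Quartic residue symbol `(α/γ)₄`, extended multiplicatively over the prime
factorization of `γ`, and declared `0` when `α, γ` are not coprime. -/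
def quarticSym (α γ : Zi) : ℂ :=
  if IsCoprime α γ then
    ((UniqueFactorizationMonoid.factors γ).map
      fun π => GaussianInt.toComplex (quarticPrime α π)).prod
  else 0

/-- Quadratic residue symbol `(α/γ)₂ = (α/γ)₄²`. -/
def quadSym (α γ : Zi) : ℂ := quarticSym α γ ^ 2

/-- Quartic Gauss sum `g₄(ν, c) = Σ_{d mod c} (d/c)₄ ě(ν d / c)`. -/
def g4 (ν : ℂ) (c : Zi) : ℂ :=
  ∑ᶠ x : Zi ⧸ Ideal.span {c},
    quarticSym (Quotient.out x) c *
      eCheck (ν * GaussianInt.toComplex (Quotient.out x) / GaussianInt.toComplex c)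

/-- Quadratic Gauss sum `g₂(ν, c) = Σ_{d mod c} (d/c)₂ ě(ν d / c)`. -/
def g2 (ν : ℂ) (c : Zi) : ℂ :=
  ∑ᶠ x : Zi ⧸ Ideal.span {c},
    quadSym (Quotient.out x) c *
      eCheck (ν * GaussianInt.toComplex (Quotient.out x) / GaussianInt.toComplex c)

/-- Euler totient on `ℤ[i]`. -/
def phiZ (c : Zi) : ℕ := Nat.card ((Zi ⧸ Ideal.span {c})ˣ)

/-- The twisted Dirichlet series of quartic Gauss sums
`ψ_α(r, s; v) = Σ_{c ≡ v (4), (c,α)=1} g₄(r,c) / N(c)^s`. -/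
def psiA (α : Zi) (r s : ℂ) (v : Zi) : ℂ :=
  ∑' c : Zi, if (4 : Zi) ∣ c - v ∧ IsCoprime c α then g4 r c / (Ni c : ℂ) ^ s else 0

def gaussianBasis : Module.Basis (Fin 2) ℤ Zi :=
  .ofEquivFun
    { toFun := fun x => ![x.re, x.im]
      invFun := fun f => ⟨f 0, f 1⟩
      map_add' := fun x y => by ext i; fin_cases i <;> simp
      map_smul' := fun n x => by ext i; fin_cases i <;> simp
      left_inv := fun x => by ext <;> simp
      right_inv := fun f => by ext i; fin_cases i <;> simp }

instance : Module.Free ℤ Zi := .of_basis gaussianBasis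

instance : Module.Finite ℤ Zi := .of_basis gaussianBasis

theorem algebraNorm_eq (c : Zi) : Algebra.norm ℤ c = Zsqrtd.norm c := by
  rw [Algebra.norm_eq_matrix_det gaussianBasis, Matrix.det_fin_two]
  simp [Algebra.leftMulMatrix_apply, LinearMap.toMatrix_apply, gaussianBasis, Zsqrtd.norm_def]

theorem card_quotient (c : Zi) :
    Nat.card (Zi ⧸ Ideal.span {c}) = (Zsqrtd.norm c).natAbs := by
  rw [← algebraNorm_eq, ← Ideal.absNorm_span_singleton, Ideal.absNorm_apply,
    Submodule.cardQuot_apply]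

theorem finite_quotient {c : Zi} (hc : c ≠ 0) : Finite (Zi ⧸ Ideal.span {c}) := by
  apply Nat.finite_of_card_ne_zero
  rw [card_quotient]
  simpa [GaussianInt.norm_eq_zero] using hc

theorem dvd_out_sub (c d : Zi) :
    c ∣ Quotient.out (Ideal.Quotient.mk (Ideal.span {c}) d) - d := by
  rw [← Ideal.mem_span_singleton, ← Ideal.Quotient.eq, Ideal.Quotient.mk_out]

/-- Sum of `F` over a system of representatives modulo `c`. -/
def residueSum (c : Zi) (F : Zi → ℂ) : ℂ :=
  ∑ᶠ x : Zi ⧸ Ideal.span {c}, F (Quotient.out x)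

/-- `F` is a function on residue classes modulo `c`. -/
def PeriodicMod (c : Zi) (F : Zi → ℂ) : Prop := ∀ d e, c ∣ d - e → F d = F e

theorem residueSum_const_mul (c : Zi) (a : ℂ) (F : Zi → ℂ) :
    residueSum c (fun d => a * F d) = a * residueSum c F :=
  (mul_finsum _ _).symm

theorem residueSum_congr {c : Zi} {F G : Zi → ℂ} (h : ∀ d, F d = G d) :
    residueSum c F = residueSum c G := by
  rw [funext h]

theorem residueSum_const {c : Zi} (hc : c ≠ 0) (a : ℂ) :
    residueSum c (fun _ => a) = Ni c * a := by
  have := finite_quotient hc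
  have := Fintype.ofFinite (Zi ⧸ Ideal.span {c})
  rw [residueSum, finsum_eq_sum_of_fintype, Finset.sum_const, nsmul_eq_mul, Finset.card_univ,
    ← Nat.card_eq_fintype_card, card_quotient, GaussianInt.natCast_natAbs_norm, Ni]

/-- Reindexing a sum over residues by an affine substitution `d ↦ u d + t`. -/
theorem residueSum_affine {c : Zi} (hc : c ≠ 0) {F : Zi → ℂ} (hF : PeriodicMod c F) {u : Zi}
    (hu : IsCoprime u c) (t : Zi) :
    residueSum c (fun d => F (u * d + t)) = residueSum c F := by
  have := finite_quotient hc
  have hinj : Function.Injective fun x : Zi ⧸ Ideal.span {c} =>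
      Ideal.Quotient.mk (Ideal.span {c}) (u * Quotient.out x + t) := by
    intro x y hxy
    rw [Ideal.Quotient.eq, Ideal.mem_span_singleton] at hxy
    have : c ∣ u * (Quotient.out x - Quotient.out y) := by
      convert hxy using 1; ring
    have := hu.symm.dvd_of_dvd_mul_left this
    rwa [← Ideal.mem_span_singleton, ← Ideal.Quotient.eq, Ideal.Quotient.mk_out,
      Ideal.Quotient.mk_out] at this
  exact finsum_eq_of_bijective _ (Finite.injective_iff_bijective.mp hinj)
    fun x => (hF _ _ (dvd_out_sub _ _)).symm

/-- Residues modulo `a b` are `w x + a y` with `x` modulo `a` and `y` modulo `b`. -/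
theorem residueSum_mul {a b w : Zi} (ha : a ≠ 0) (hb : b ≠ 0) (hw : IsCoprime w a)
    {F : Zi → ℂ} (hF : PeriodicMod (a * b) F) :
    residueSum (a * b) F = residueSum a (fun x => residueSum b (fun y => F (w * x + a * y))) := by
  have := finite_quotient ha
  have := finite_quotient hb
  have := finite_quotient (mul_ne_zero ha hb)
  have := Fintype.ofFinite (Zi ⧸ Ideal.span {a})
  have := Fintype.ofFinite (Zi ⧸ Ideal.span {b})
  have := Fintype.ofFinite (Zi ⧸ Ideal.span {a * b})
  have hinj : Function.Injective fun x : (Zi ⧸ Ideal.span {a}) × (Zi ⧸ Ideal.span {b}) =>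
      Ideal.Quotient.mk (Ideal.span {a * b}) (w * Quotient.out x.1 + a * Quotient.out x.2) := by
    rintro ⟨x, y⟩ ⟨x', y'⟩ h
    simp only [Ideal.Quotient.eq, Ideal.mem_span_singleton] at h
    have hx : x = x' := by
      have h1 : a ∣ w * (Quotient.out x - Quotient.out x') := by
        have := (dvd_of_mul_right_dvd h).sub
          (dvd_mul_right a (Quotient.out y - Quotient.out y'))
        convert this using 1; ring
      have := hw.symm.dvd_of_dvd_mul_left h1
      rwa [← Ideal.mem_span_singleton, ← Ideal.Quotient.eq, Ideal.Quotient.mk_out,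
        Ideal.Quotient.mk_out] at this
    subst hx
    have h2 : a * b ∣ a * (Quotient.out y - Quotient.out y') := by
      convert h using 1; ring
    have := (mul_dvd_mul_iff_left ha).mp h2
    rw [← Ideal.mem_span_singleton, ← Ideal.Quotient.eq, Ideal.Quotient.mk_out,
        Ideal.Quotient.mk_out] at this
    rw [this]
  have hbij := (Fintype.bijective_iff_injective_and_card _).mpr ⟨hinj, by
    simp only [← Nat.card_eq_fintype_card, Nat.card_prod, card_quotient, Zsqrtd.norm_mul,
      Int.natAbs_mul]⟩
  simp only [residueSum, finsum_eq_sum_of_fintype]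
  rw [← Fintype.sum_prod_type']
  exact (Fintype.sum_bijective _ hbij _ _ fun x => (hF _ _ (dvd_out_sub _ _)).symm).symm

theorem eCheck_add (x y : ℂ) : eCheck (x + y) = eCheck x * eCheck y := by
  rw [eCheck, eCheck, eCheck, ← Complex.exp_add, map_add]
  congr 1; ring

theorem toComplex_lam_sq : GaussianInt.toComplex lam ^ 2 = 2 * I := by
  simp [lam, GaussianInt.toComplex_def']
  linear_combination Complex.I_sq

theorem eCheck_div_lam_sq (z : ℂ) :
    eCheck (z / GaussianInt.toComplex lam ^ 2) = Complex.exp (z.im * (2 * Real.pi * I)) := by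
  rw [eCheck, toComplex_lam_sq, Complex.add_conj]
  congr 1
  have : (z / (2 * I)).re = z.im / 2 := by
    have : z / (2 * I) = -(z * I) / 2 := by field_simp; simp
    rw [this]; simp
  rw [this]; push_cast; ring

theorem eCheck_lattice (a : Zi) :
    eCheck (GaussianInt.toComplex a / GaussianInt.toComplex lam ^ 2) = 1 := by
  rw [eCheck_div_lam_sq, ← GaussianInt.intCast_im]
  exact_mod_cast Complex.exp_int_mul_two_pi_mul_I _

theorem exists_im_eq_int_of_eCheck_eq_one {z : ℂ}
    (h : eCheck (z / GaussianInt.toComplex lam ^ 2) = 1) : ∃ n : ℤ, z.im = n := by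
  rw [eCheck_div_lam_sq, Complex.exp_eq_one_iff] at h
  obtain ⟨n, hn⟩ := h
  refine ⟨n, ?_⟩
  have := mul_right_cancel₀ Complex.two_pi_I_ne_zero hn
  exact_mod_cast this

theorem eCheck_add_lattice (z : ℂ) (a : Zi) :
    eCheck (z + GaussianInt.toComplex a / GaussianInt.toComplex lam ^ 2) = eCheck z := by
  rw [eCheck_add, eCheck_lattice, mul_one]

/-- The additive character `d ↦ ě(a d / (λ² c))` is periodic modulo `c`. -/
theorem eCheck_periodic (a : Zi) {c d e : Zi} (hc : c ≠ 0) (h : c ∣ d - e) :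
    eCheck (GaussianInt.toComplex a / GaussianInt.toComplex lam ^ 2 *
      GaussianInt.toComplex d / GaussianInt.toComplex c) =
    eCheck (GaussianInt.toComplex a / GaussianInt.toComplex lam ^ 2 *
      GaussianInt.toComplex e / GaussianInt.toComplex c) := by
  obtain ⟨k, hk⟩ := h
  have hc' : GaussianInt.toComplex c ≠ 0 := GaussianInt.toComplex_eq_zero.not.mpr hc
  obtain rfl : d = e + c * k := by rw [← hk]; ring
  refine Eq.trans ?_ (eCheck_add_lattice _ (a * k))
  congr 1
  simp only [map_add, map_mul]
  field_simp

theorem exists_eCheck_ne_one {m π : Zi} (hπ : π ≠ 0) (hm : ¬ π ∣ m) :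
    ∃ t : Zi, eCheck (GaussianInt.toComplex m / GaussianInt.toComplex lam ^ 2 *
      GaussianInt.toComplex t / GaussianInt.toComplex π) ≠ 1 := by
  by_contra! h
  have hπ' : GaussianInt.toComplex π ≠ 0 := GaussianInt.toComplex_eq_zero.not.mpr hπ
  have key (t : Zi) : ∃ n : ℤ,
      (GaussianInt.toComplex m / GaussianInt.toComplex π * GaussianInt.toComplex t).im = n := by
    apply exists_im_eq_int_of_eCheck_eq_one
    rw [← h t]
    congr 1
    ring
  obtain ⟨y, hy⟩ := key 1
  obtain ⟨x, hx⟩ := key ⟨0, 1⟩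
  have hI : GaussianInt.toComplex ⟨0, 1⟩ = I := by simp [GaussianInt.toComplex_def']
  rw [hI, Complex.mul_I_im] at hx
  rw [map_one, mul_one] at hy
  apply hm
  refine ⟨⟨x, y⟩, ?_⟩
  rw [← GaussianInt.toComplex_inj, map_mul]
  have : GaussianInt.toComplex m / GaussianInt.toComplex π = GaussianInt.toComplex ⟨x, y⟩ := by
    apply Complex.ext
    · rw [hx, GaussianInt.re_toComplex]
    · rw [hy, GaussianInt.im_toComplex]
  rw [← this]
  field_simp

theorem lam_dvd_iff (x : Zi) : lam ∣ x ↔ Even (x.re + x.im) := by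
  constructor
  · rintro ⟨k, rfl⟩
    exact ⟨k.re, by simp [lam]⟩
  · rintro ⟨k, hk⟩
    refine ⟨⟨k, x.im - k⟩, ?_⟩
    ext
    · simp [lam]; linarith
    · simp [lam]

theorem Ni_mod_four {x : Zi} (hx : ¬ lam ∣ x) : Ni x % 4 = 1 := by
  rw [lam_dvd_iff, Int.not_even_iff_odd] at hx
  rw [Ni, Zsqrtd.norm_def]
  rcases Int.even_or_odd' x.re with ⟨a, ha | ha⟩ <;>
  rcases Int.even_or_odd' x.im with ⟨b, hb | hb⟩ <;> rw [ha, hb] at hx ⊢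
  · exact absurd hx (by simp [parity_simps])
  · ring_nf; omega
  · ring_nf; omega
  · exact absurd hx (by simp [parity_simps])

theorem Ni_pos {x : Zi} (hx : x ≠ 0) : 0 < Ni x := GaussianInt.norm_pos.mpr hx

theorem card_residue_field {π : Zi} (hπ : π ≠ 0) :
    Nat.card (Zi ⧸ Ideal.span {π}) = (Ni π).toNat := by
  rw [card_quotient]
  have := Ni_pos hπ
  rw [Ni] at *
  omega

theorem isMaximal_span {π : Zi} (hπ : Prime π) : (Ideal.span {π}).IsMaximal :=
  PrincipalIdealRing.isMaximal_of_irreducible hπ.irreducible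

theorem dvd_pow_sub_one {π α : Zi} (hπ : Prime π) (hα : ¬ π ∣ α) :
    π ∣ α ^ ((Ni π).toNat - 1) - 1 := by
  have := isMaximal_span hπ
  let := Ideal.Quotient.field (Ideal.span {π})
  have := finite_quotient hπ.ne_zero
  have := Fintype.ofFinite (Zi ⧸ Ideal.span {π})
  have h0 : Ideal.Quotient.mk (Ideal.span {π}) α ≠ 0 := by
    rwa [Ne, Ideal.Quotient.eq_zero_iff_mem, Ideal.mem_span_singleton]
  have := FiniteField.pow_card_sub_one_eq_one _ h0
  rw [← Nat.card_eq_fintype_card, card_residue_field hπ.ne_zero, ← map_pow,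
    ← map_one (Ideal.Quotient.mk (Ideal.span {π})), Ideal.Quotient.eq,
    Ideal.mem_span_singleton] at this
  exact this

theorem exists_not_dvd_pow_sub_one {π : Zi} (hπ : Prime π) {k : ℕ} (hk : 0 < k)
    (hk' : k < (Ni π).toNat - 1) : ∃ α : Zi, ¬ π ∣ α ∧ ¬ π ∣ α ^ k - 1 := by
  have := isMaximal_span hπ
  let := Ideal.Quotient.field (Ideal.span {π})
  have := finite_quotient hπ.ne_zero
  have := Fintype.ofFinite (Zi ⧸ Ideal.span {π})
  obtain ⟨g, hg⟩ := IsCyclic.exists_ofOrder_eq_natCard (α := (Zi ⧸ Ideal.span {π})ˣ)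
  rw [Nat.card_eq_fintype_card, Fintype.card_units, ← Nat.card_eq_fintype_card,
    card_residue_field hπ.ne_zero] at hg
  obtain ⟨α, hα⟩ := Ideal.Quotient.mk_surjective g.val
  refine ⟨α, fun h => ?_, fun h => ?_⟩
  · rw [← Ideal.mem_span_singleton, ← Ideal.Quotient.eq_zero_iff_mem, hα] at h
    exact g.ne_zero h
  · rw [← Ideal.mem_span_singleton, ← Ideal.Quotient.eq, map_pow, hα, map_one] at h
    have : g ^ k = 1 := by ext; simpa using h
    have := orderOf_le_of_pow_eq_one hk this
    omega

theorem eq_of_pow_four_eq_one {u : Zi} (hu : u ^ 4 = 1) :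
    u = 1 ∨ u = -1 ∨ u = ⟨0, 1⟩ ∨ u = ⟨0, -1⟩ := by
  have h : (u - 1) * ((u + 1) * ((u - ⟨0, 1⟩) * (u - ⟨0, -1⟩))) = 0 := by
    have h1 : (u - ⟨0, 1⟩) * (u - ⟨0, -1⟩) = u ^ 2 + 1 := by
      ext <;> simp [pow_two] <;> ring
    rw [h1]; linear_combination hu
  simp only [mul_eq_zero, sub_eq_zero] at h
  rcases h with h | h | h | h
  · exact .inl h
  · exact .inr (.inl (eq_neg_of_add_eq_zero_left h))
  · exact .inr (.inr (.inl h))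
  · exact .inr (.inr (.inr h))

theorem norm_ne_one {π : Zi} (hπ : Prime π) : Ni π ≠ 1 := fun h =>
  hπ.not_isUnit ((Zsqrtd.norm_eq_one_iff' (by norm_num) π).mp h)

theorem eq_of_dvd_sub {π u v : Zi} (hπ : Prime π) (hodd : ¬ lam ∣ π) (hu : u ^ 4 = 1)
    (hv : v ^ 4 = 1) (h : π ∣ u - v) : u = v := by
  have h1 := Ni_mod_four hodd
  have h2 := norm_ne_one hπ
  have h3 := Ni_pos hπ.ne_zero
  have hd : Ni π ∣ Ni (u - v) := by
    obtain ⟨k, hk⟩ := h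
    exact ⟨Ni k, by rw [hk, Ni, Zsqrtd.norm_mul]; rfl⟩
  have h4 : Ni (u - v) = 2 ∨ Ni (u - v) = 4 → False := by
    intro h
    have : Ni π ∣ 4 := by
      rcases h with h | h <;> rw [h] at hd
      · exact hd.trans (by norm_num)
      · exact hd
    have := Int.le_of_dvd (by norm_num) this
    interval_cases Ni π <;> omega
  by_contra hne
  apply h4
  rcases eq_of_pow_four_eq_one hu with rfl | rfl | rfl | rfl <;>
  rcases eq_of_pow_four_eq_one hv with rfl | rfl | rfl | rfl <;>
  first
  | exact absurd rfl hne
  | (simp [Ni, Zsqrtd.norm_def])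

theorem quarticPrime_spec {π α : Zi} (hπ : Prime π) (hodd : ¬ lam ∣ π) (hα : ¬ π ∣ α) :
    quarticPrime α π ^ 4 = 1 ∧ π ∣ α ^ ((Ni π - 1) / 4).toNat - quarticPrime α π := by
  have hex : ∃ u : Zi, u ^ 4 = 1 ∧ π ∣ α ^ ((Ni π - 1) / 4).toNat - u := by
    have h := dvd_pow_sub_one hπ hα
    have h1 := Ni_mod_four hodd
    have h2 := Ni_pos hπ.ne_zero
    have h3 : (Ni π).toNat - 1 = ((Ni π - 1) / 4).toNat * 4 := by omega
    rw [h3, pow_mul] at h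
    set x := α ^ ((Ni π - 1) / 4).toNat
    have h4 : x ^ 4 - 1 = (x - 1) * ((x - -1) * ((x - ⟨0, 1⟩) * (x - ⟨0, -1⟩))) := by
      have h1 : (x - ⟨0, 1⟩) * (x - ⟨0, -1⟩) = x ^ 2 + 1 := by
        ext <;> simp [pow_two] <;> ring
      rw [h1]; ring
    rw [h4] at h
    rcases hπ.dvd_or_dvd h with h | h
    · exact ⟨_, by norm_num, h⟩
    rcases hπ.dvd_or_dvd h with h | h
    · exact ⟨_, by norm_num, h⟩
    rcases hπ.dvd_or_dvd h with h | h
    · exact ⟨_, by decide, h⟩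
    · exact ⟨_, by decide, h⟩
  rw [quarticPrime, dif_pos hex]
  exact hex.choose_spec

theorem quarticPrime_eq {π α u : Zi} (hπ : Prime π) (hodd : ¬ lam ∣ π) (hα : ¬ π ∣ α)
    (hu : u ^ 4 = 1) (h : π ∣ α ^ ((Ni π - 1) / 4).toNat - u) : quarticPrime α π = u := by
  obtain ⟨h1, h2⟩ := quarticPrime_spec hπ hodd hα
  exact eq_of_dvd_sub hπ hodd h1 hu (by convert h.sub h2 using 1; ring)

theorem quarticPrime_mul {π α β : Zi} (hπ : Prime π) (hodd : ¬ lam ∣ π) (hα : ¬ π ∣ α)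
    (hβ : ¬ π ∣ β) : quarticPrime (α * β) π = quarticPrime α π * quarticPrime β π := by
  obtain ⟨h1, h2⟩ := quarticPrime_spec hπ hodd hα
  obtain ⟨h3, h4⟩ := quarticPrime_spec hπ hodd hβ
  refine quarticPrime_eq hπ hodd (fun h => (hπ.dvd_or_dvd h).elim hα hβ)
    (by rw [mul_pow, h1, h3, one_mul]) ?_
  rw [mul_pow]
  exact dvd_mul_sub_mul h2 h4

theorem quarticPrime_congr {π α β : Zi} (h : π ∣ α - β) :
    quarticPrime α π = quarticPrime β π := by
  have key (u : Zi) (k : ℕ) : π ∣ α ^ k - u ↔ π ∣ β ^ k - u := by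
    have h1 : π ∣ α ^ k - β ^ k := h.trans (sub_dvd_pow_sub_pow α β k)
    rw [← dvd_add_right h1 (c := β ^ k - u), sub_add_sub_cancel]
  simp only [quarticPrime, key]

theorem Ni_associated {π ρ : Zi} (h : Associated π ρ) : Ni π = Ni ρ :=
  Zsqrtd.norm_eq_of_associated (by norm_num) h

theorem quarticPrime_associated {π ρ : Zi} (h : Associated π ρ) (α : Zi) :
    quarticPrime α π = quarticPrime α ρ := by
  simp only [quarticPrime, Ni_associated h, h.dvd_iff_dvd_left]

theorem ne_zero_of_not_lam_dvd {c : Zi} (hc : ¬ lam ∣ c) : c ≠ 0 := by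
  rintro rfl
  exact hc (dvd_zero _)

theorem isCoprime_iff_forall_prime {c : Zi} (hc : c ≠ 0) (d : Zi) :
    IsCoprime d c ↔ ∀ p, Prime p → p ∣ c → ¬ p ∣ d := by
  constructor
  · intro h p hp hpc hpd
    exact hp.not_isUnit (h.isUnit_of_dvd' hpd hpc)
  · intro h
    exact isCoprime_of_prime_dvd (fun h0 => hc h0.2) fun p hp hpd hpc => h p hp hpc hpd

theorem not_dvd_of_isCoprime {p c d : Zi} (hp : Prime p) (h : IsCoprime d c) (hpc : p ∣ c) :
    ¬ p ∣ d :=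
  fun hpd => hp.not_isUnit (h.isUnit_of_dvd' hpd hpc)

theorem isCoprime_prime_iff {π : Zi} (hπ : Prime π) (d : Zi) : IsCoprime d π ↔ ¬ π ∣ d := by
  rw [isCoprime_comm, hπ.coprime_iff_not_dvd]

theorem quarticSym_congr {c d e : Zi} (hc : c ≠ 0)
    (h : ∀ p, Prime p → p ∣ c → p ∣ d - e) : quarticSym d c = quarticSym e c := by
  have h1 : IsCoprime d c ↔ IsCoprime e c := by
    rw [isCoprime_iff_forall_prime hc, isCoprime_iff_forall_prime hc]
    refine forall₃_congr fun p hp hpc => not_congr ?_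
    rw [← dvd_add_right (h p hp hpc) (c := e), sub_add_cancel]
  have h2 : (UniqueFactorizationMonoid.factors c).map
      (fun p => GaussianInt.toComplex (quarticPrime d p)) =
      (UniqueFactorizationMonoid.factors c).map
      (fun p => GaussianInt.toComplex (quarticPrime e p)) :=
    Multiset.map_congr rfl fun p hp => by
      rw [quarticPrime_congr (h p (UniqueFactorizationMonoid.prime_of_factor p hp)
        (UniqueFactorizationMonoid.dvd_of_mem_factors hp))]
  simp only [quarticSym, h1, h2]

theorem quarticSym_mul_left {c : Zi} (hc : ¬ lam ∣ c) (d e : Zi) :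
    quarticSym (d * e) c = quarticSym d c * quarticSym e c := by
  by_cases hd : IsCoprime d c
  · by_cases he : IsCoprime e c
    · rw [quarticSym, quarticSym, quarticSym, if_pos hd, if_pos he, if_pos (hd.mul_left he),
        ← Multiset.prod_map_mul]
      congr 1
      refine Multiset.map_congr rfl fun p hp => ?_
      have hpc := UniqueFactorizationMonoid.dvd_of_mem_factors hp
      have hp' := UniqueFactorizationMonoid.prime_of_factor p hp
      rw [quarticPrime_mul hp' (fun h => hc (h.trans hpc)) (not_dvd_of_isCoprime hp' hd hpc)
        (not_dvd_of_isCoprime hp' he hpc), map_mul]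
    · have : ¬ IsCoprime (d * e) c := fun h => he h.of_mul_left_right
      rw [quarticSym, quarticSym, quarticSym, if_neg this, if_neg he, mul_zero]
  · have : ¬ IsCoprime (d * e) c := fun h => hd h.of_mul_left_left
    rw [quarticSym, quarticSym, quarticSym, if_neg this, if_neg hd, zero_mul]

theorem prod_quarticPrime_eq_of_rel (d : Zi) {s t : Multiset Zi}
    (h : Multiset.Rel Associated s t) :
    (s.map fun p => GaussianInt.toComplex (quarticPrime d p)).prod =
      (t.map fun p => GaussianInt.toComplex (quarticPrime d p)).prod := by
  have : Multiset.Rel Eq (s.map fun p => GaussianInt.toComplex (quarticPrime d p))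
      (t.map fun p => GaussianInt.toComplex (quarticPrime d p)) := by
    rw [Multiset.rel_map]
    exact h.mono fun a _ b _ hab => by rw [quarticPrime_associated hab]
  rw [Multiset.rel_eq.mp this]

theorem quarticSym_mul_right {c c' : Zi} (hc : c ≠ 0) (hc' : c' ≠ 0) (d : Zi) :
    quarticSym d (c * c') = quarticSym d c * quarticSym d c' := by
  by_cases hd : IsCoprime d c
  · by_cases hd' : IsCoprime d c'
    · rw [quarticSym, quarticSym, quarticSym, if_pos hd, if_pos hd', if_pos (hd.mul_right hd'),
        prod_quarticPrime_eq_of_rel d (UniqueFactorizationMonoid.factors_mul hc hc'),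
        Multiset.map_add, Multiset.prod_add]
    · have : ¬ IsCoprime d (c * c') := fun h => hd' h.of_mul_right_right
      rw [quarticSym, quarticSym, quarticSym, if_neg this, if_neg hd', mul_zero]
  · have : ¬ IsCoprime d (c * c') := fun h => hd h.of_mul_right_left
    rw [quarticSym, quarticSym, quarticSym, if_neg this, if_neg hd, zero_mul]

theorem quarticSym_prime {π d : Zi} (hπ : Prime π) (hd : ¬ π ∣ d) :
    quarticSym d π = GaussianInt.toComplex (quarticPrime d π) := by
  have h : Multiset.Rel Associated (UniqueFactorizationMonoid.factors π) {π} :=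
    UniqueFactorizationMonoid.factors_unique
      (fun x hx => UniqueFactorizationMonoid.irreducible_of_factor x hx)
      (by simpa using hπ.irreducible)
      (by simpa using UniqueFactorizationMonoid.factors_prod hπ.ne_zero)
  rw [quarticSym, if_pos ((isCoprime_prime_iff hπ d).mpr hd), prod_quarticPrime_eq_of_rel d h,
    Multiset.map_singleton, Multiset.prod_singleton]

theorem quarticSym_isUnit_right {u : Zi} (hu : IsUnit u) (d : Zi) : quarticSym d u = 1 := by
  have h : Multiset.Rel Associated (UniqueFactorizationMonoid.factors u) 0 :=
    UniqueFactorizationMonoid.factors_unique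
      (fun x hx => UniqueFactorizationMonoid.irreducible_of_factor x hx)
      (by simp)
      ((UniqueFactorizationMonoid.factors_prod hu.ne_zero).trans
        (by simpa using associated_one_iff_isUnit.mpr hu))
  rw [quarticSym, if_pos (isCoprime_one_right.of_isCoprime_of_dvd_right hu.dvd),
    prod_quarticPrime_eq_of_rel d h, Multiset.map_zero, Multiset.prod_zero]

theorem quadSym_mul_left {c : Zi} (hc : ¬ lam ∣ c) (d e : Zi) :
    quadSym (d * e) c = quadSym d c * quadSym e c := by
  rw [quadSym, quarticSym_mul_left hc, mul_pow]; rfl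

theorem quadSym_mul_right {c c' : Zi} (hc : c ≠ 0) (hc' : c' ≠ 0) (d : Zi) :
    quadSym d (c * c') = quadSym d c * quadSym d c' := by
  rw [quadSym, quarticSym_mul_right hc hc', mul_pow]; rfl

theorem quadSym_congr {c d e : Zi} (hc : c ≠ 0)
    (h : ∀ p, Prime p → p ∣ c → p ∣ d - e) : quadSym d c = quadSym e c := by
  rw [quadSym, quarticSym_congr hc h, quadSym]

/-- Euler's criterion for the quadratic symbol. -/
theorem quadSym_prime_eq {π α : Zi} (hπ : Prime π) (hodd : ¬ lam ∣ π) (hα : ¬ π ∣ α) {n : ℕ}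
    (hn : Ni π = 2 * n + 1) {ε : ℤ} (hε : ε = 1 ∨ ε = -1) (h : π ∣ α ^ n - (ε : Zi)) :
    quadSym α π = ε := by
  obtain ⟨h1, h2⟩ := quarticPrime_spec hπ hodd hα
  have h3 := Ni_mod_four hodd
  have hk : n = ((Ni π - 1) / 4).toNat * 2 := by omega
  rw [hk, pow_mul] at h
  set u := quarticPrime α π with hu
  set x := α ^ ((Ni π - 1) / 4).toNat
  have h4 : π ∣ u ^ 2 - (ε : Zi) := by
    have := h.sub (h2.trans (sub_dvd_pow_sub_pow x u 2))
    convert this using 1; ring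
  have h5 : u ^ 2 = (ε : Zi) := by
    refine eq_of_dvd_sub hπ hodd ?_ ?_ h4
    · rw [← pow_mul, mul_comm, pow_mul, h1, one_pow]
    · rcases hε with rfl | rfl <;> norm_num
  rw [quadSym, quarticSym_prime hπ hα, ← hu, ← map_pow, h5, map_intCast]

theorem quadSym_sq {c d : Zi} (hc : ¬ lam ∣ c) (h : IsCoprime d c) : quadSym d c ^ 2 = 1 := by
  rw [quadSym, quarticSym, if_pos h, ← pow_mul, ← Multiset.prod_map_pow]
  apply Multiset.prod_eq_one
  intro x hx
  obtain ⟨p, hp, rfl⟩ := Multiset.mem_map.mp hx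
  have hpc := UniqueFactorizationMonoid.dvd_of_mem_factors hp
  have hp' := UniqueFactorizationMonoid.prime_of_factor p hp
  rw [← map_pow, (quarticPrime_spec hp' (fun h => hc (h.trans hpc))
    (not_dvd_of_isCoprime hp' h hpc)).1, map_one]

open scoped NumberTheorySymbols

theorem natCast_Ni_eq (π : Zi) : ((Ni π : ℤ) : Zi) = π * star π := Zsqrtd.norm_eq_mul_conj π

/-- An odd Gaussian prime either has prime norm or is associated to an inert rational prime. -/
theorem prime_norm_or_inert {π : Zi} (hπ : Prime π) :
    (∃ p : ℕ, p.Prime ∧ Ni π = p) ∨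
      ∃ q : ℕ, q.Prime ∧ q % 4 = 3 ∧ Associated π (q : Zi) := by
  have h0 := Ni_pos hπ.ne_zero
  have h1 : π ∣ (((Ni π).natAbs.primeFactorsList.map (Nat.cast : ℕ → Zi)).prod) := by
    rw [← Nat.cast_list_prod, Nat.prod_primeFactorsList (by omega)]
    have : (((Ni π).natAbs : ℕ) : Zi) = π * star π := by
      rw [← natCast_Ni_eq, Ni, GaussianInt.natCast_natAbs_norm]
    rw [this]
    exact dvd_mul_right _ _
  obtain ⟨a, ha, hπa⟩ := hπ.dvd_prod_iff.mp h1
  obtain ⟨p, hp, rfl⟩ := List.mem_map.mp ha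
  have hp := Nat.prime_of_mem_primeFactorsList hp
  obtain ⟨k, hk⟩ := hπa
  have hN : (Ni π).natAbs * (Ni k).natAbs = p ^ 2 := by
    rw [← Int.natAbs_mul, Ni, Ni, ← Zsqrtd.norm_mul, ← hk, Zsqrtd.norm_natCast, Int.natAbs_mul,
      Int.natAbs_natCast, sq]
  obtain ⟨j, hj, hNj⟩ := (Nat.dvd_prime_pow hp).mp ⟨_, hN.symm⟩
  have h2 := norm_ne_one hπ
  interval_cases j
  · rw [pow_zero] at hNj
    omega
  · rw [pow_one] at hNj
    exact .inl ⟨p, hp, by omega⟩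
  · right
    have hk1 : (Ni k).natAbs = 1 := by
      rw [hNj] at hN
      exact Nat.eq_of_mul_eq_mul_left (pow_pos hp.pos 2) (by rw [hN, mul_one])
    have hku : IsUnit k := (Zsqrtd.norm_eq_one_iff).mp hk1
    have hass : Associated π (p : Zi) := hk ▸ (associated_mul_unit_right π k hku)
    have := Fact.mk hp
    exact ⟨p, hp, (GaussianInt.prime_iff_mod_four_eq_three_of_nat_prime p).mp
      (hass.prime hπ), hass⟩

theorem legendreSym_dvd (p : ℕ) [Fact p.Prime] (n : ℤ) :
    (p : ℤ) ∣ n ^ (p / 2) - legendreSym p n := by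
  rw [← ZMod.intCast_eq_intCast_iff_dvd_sub, legendreSym.eq_pow, Int.cast_pow]

theorem quadSym_intCast {π : Zi} (hπ : Prime π) (hodd : ¬ lam ∣ π) {p : ℕ} [Fact p.Prime]
    (hp : Ni π = p) {n : ℤ} (hn : ¬ π ∣ (n : Zi)) : quadSym (n : Zi) π = legendreSym p n := by
  have hπp : π ∣ ((p : ℤ) : Zi) := by
    rw [← hp, natCast_Ni_eq]; exact dvd_mul_right _ _
  have h4 := Ni_mod_four hodd
  refine quadSym_prime_eq hπ hodd hn (n := p / 2) (by omega) ?_ ?_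
  · refine legendreSym.eq_one_or_neg_one p fun h => hn ?_
    rw [ZMod.intCast_zmod_eq_zero_iff_dvd] at h
    exact hπp.trans (Int.cast_dvd_cast _ _ h)
  · have := hπp.trans (Int.cast_dvd_cast (α := Zi) _ _ (legendreSym_dvd p n))
    simpa using this

theorem gaussianI_sq : (⟨0, 1⟩ : Zi) ^ 2 = -1 := by decide

/-- Frobenius at an inert prime is complex conjugation. -/
theorem inert_dvd_pow_sub_star {q : ℕ} (hq : q.Prime) (hq3 : q % 4 = 3) (α : Zi) :
    (q : Zi) ∣ α ^ q - star α := by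
  have := Fact.mk hq
  have hα : α = (α.re : Zi) + (α.im : Zi) * ⟨0, 1⟩ := by ext <;> simp
  have hα' : star α = (α.re : Zi) - (α.im : Zi) * ⟨0, 1⟩ := by ext <;> simp
  have hint (n : ℤ) : (q : Zi) ∣ (n : Zi) ^ q - n := by
    have : (q : ℤ) ∣ n ^ q - n := by
      rw [← ZMod.intCast_eq_intCast_iff_dvd_sub, Int.cast_pow, ZMod.pow_card]
    simpa using Int.cast_dvd_cast (α := Zi) _ _ this
  have hI : (⟨0, 1⟩ : Zi) ^ q = -⟨0, 1⟩ := by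
    obtain ⟨k, hk⟩ : ∃ k, q = 2 * (2 * k + 1) + 1 := ⟨q / 4, by omega⟩
    rw [hk, pow_succ, pow_mul, gaussianI_sq, pow_succ, pow_mul]
    simp
  obtain ⟨r, hr⟩ := exists_add_pow_prime_eq hq (α.re : Zi) ((α.im : Zi) * ⟨0, 1⟩)
  rw [← hα, mul_pow, hI] at hr
  rw [hr, hα']
  have h1 := (hint α.re).sub ((hint α.im).mul_right ⟨0, 1⟩)
  have h2 : (q : Zi) ∣ q * (α.re : Zi) * ((α.im : Zi) * ⟨0, 1⟩) * r :=
    ⟨(α.re : Zi) * ((α.im : Zi) * ⟨0, 1⟩) * r, by ring⟩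
  convert h1.add h2 using 1
  ring

theorem quadSym_inert {π : Zi} (hπ : Prime π) (hodd : ¬ lam ∣ π) {q : ℕ} [Fact q.Prime]
    (hq3 : q % 4 = 3) (hass : Associated π (q : Zi)) {α : Zi} (hα : ¬ π ∣ α) :
    quadSym α π = legendreSym q (Ni α) := by
  have hq : q.Prime := Fact.out
  have hfrob := hass.dvd.trans (inert_dvd_pow_sub_star hq hq3 α)
  have hstar : ¬ π ∣ star α := fun h => hα (hπ.dvd_of_dvd_pow ((dvd_sub_comm.mp hfrob |>
    fun h' => (dvd_sub_right h).mp h')))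
  have hN : Ni π = q ^ 2 := by
    rw [Ni_associated hass, Ni, Zsqrtd.norm_natCast, sq]
  obtain ⟨k, hk⟩ : ∃ k, q = 4 * k + 3 := ⟨q / 4, by omega⟩
  refine quadSym_prime_eq hπ hodd hα (n := (q + 1) * (2 * k + 1)) ?_ ?_ ?_
  · rw [hN, hk]; push_cast; ring
  · refine legendreSym.eq_one_or_neg_one q fun h => ?_
    rw [ZMod.intCast_zmod_eq_zero_iff_dvd] at h
    have := hass.dvd.trans (by simpa using Int.cast_dvd_cast (α := Zi) _ _ h)
    rw [natCast_Ni_eq] at this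
    exact (hπ.dvd_or_dvd this).elim hα hstar
  · have h1 : π ∣ α ^ (q + 1) - (Ni α : Zi) := by
      rw [natCast_Ni_eq, pow_succ, mul_comm α, ← sub_mul]
      exact hfrob.mul_right α
    have h2 := h1.trans (sub_dvd_pow_sub_pow _ _ (2 * k + 1))
    rw [← pow_mul] at h2
    have h3 := hass.dvd.trans
      (by simpa using Int.cast_dvd_cast (α := Zi) _ _ (legendreSym_dvd q (Ni α)))
    rw [show q / 2 = 2 * k + 1 by omega] at h3
    convert h2.add h3 using 1
    ring

theorem jacobiSym_comm_of_one_mod_four {c : ℤ} (hc : Odd c) {q : ℕ} (hq : q % 4 = 1) :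
    J(c | q) = J(q | c.natAbs) := by
  have hqo : Odd q := Nat.odd_iff.mpr (by omega)
  have h := jacobiSym.quadratic_reciprocity_one_mod_four hq (Int.natAbs_odd.mpr hc)
  rw [h]
  rcases Int.natAbs_eq c with hc' | hc'
  · rw [← hc']
  · conv_lhs => rw [hc']
    rw [jacobiSym.neg _ hqo, ZMod.χ₄_nat_one_mod_four hq, one_mul]

/-- If `m` is odd and `n² ≡ N (mod m)` with `N ≡ 1 (mod 4)` prime to `m`, then `(m/N) = 1`. -/
theorem jacobiSym_eq_one_of_sq {m n : ℤ} {N : ℕ} (hm : Odd m) (hN : N % 4 = 1)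
    (h : m ∣ N - n ^ 2) (hcop : IsCoprime m N) : J(m | N) = 1 := by
  rw [jacobiSym_comm_of_one_mod_four hm hN]
  have h1 : J((N : ℤ) | m.natAbs) = J(n ^ 2 | m.natAbs) := by
    apply jacobiSym.mod_left'
    exact ((Int.modEq_iff_dvd).mpr (by
      rw [Int.natCast_natAbs, abs_dvd]; exact h)).symm
  rw [h1]
  apply jacobiSym.sq_one'
  have h2 : IsCoprime m n := by
    obtain ⟨k, hk⟩ := h
    have h3 : IsCoprime m (n ^ 2) := by
      have : n ^ 2 = N + m * (-k) := by linarith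
      rw [this]
      exact hcop.add_mul_left_right _
    exact (IsCoprime.pow_right_iff (by norm_num)).mp h3
  rw [Int.gcd, Int.natAbs_natCast, ← Int.gcd]
  exact Int.isCoprime_iff_gcd_eq_one.mp h2.symm

theorem odd_re_of_even_im {x : Zi} (hodd : ¬ lam ∣ x) (him : Even x.im) : Odd x.re := by
  rw [lam_dvd_iff, Int.not_even_iff_odd] at hodd
  simpa using hodd.sub_even him

theorem not_dvd_intCast_of_prime_norm {π : Zi} (hπ : Prime π) {p : ℕ} (hp : p.Prime)
    (hN : Ni π = p) {n : ℤ} (hn : ¬ (p : ℤ) ∣ n) : ¬ π ∣ (n : Zi) := by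
  intro h
  have hcop : IsCoprime (p : ℤ) n := (Nat.prime_iff_prime_int.mp hp).coprime_iff_not_dvd.mpr hn
  have h1 := hcop.map (Int.castRingHom Zi)
  refine hπ.not_isUnit (h1.isUnit_of_dvd' ?_ h)
  rw [← hN]
  change π ∣ ((Ni π : ℤ) : Zi)
  rw [natCast_Ni_eq]
  exact dvd_mul_right _ _

theorem dvd_intCast_of_dvd {π : Zi} {p : ℕ} (hN : Ni π = p) {n : ℤ} (hn : (p : ℤ) ∣ n) :
    π ∣ (n : Zi) := by
  refine dvd_trans ?_ (Int.cast_dvd_cast (α := Zi) _ _ hn)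
  rw [← hN, natCast_Ni_eq]
  exact dvd_mul_right _ _

theorem Ni_eq (x : Zi) : Ni x = x.re ^ 2 + x.im ^ 2 := by
  rw [Ni, Zsqrtd.norm_def]; ring

/-- For a split prime `θ = c + d i` with `d` even, `(α/θ)₂` is the Legendre symbol of
`re α * c + im α * d`. -/
theorem quadSym_split {θ : Zi} (hθ : Prime θ) (hodd : ¬ lam ∣ θ) (him : Even θ.im) {q : ℕ}
    (hq : q.Prime) (hN : Ni θ = q) {α : Zi} (hα : ¬ θ ∣ α) :
    ¬ (q : ℤ) ∣ α.re * θ.re + α.im * θ.im ∧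
      quadSym α θ = J(α.re * θ.re + α.im * θ.im | q) := by
  have := Fact.mk hq
  have hre := odd_re_of_even_im hodd him
  have h4 := Ni_mod_four hodd
  have hqN : (q : ℤ) = θ.re ^ 2 + θ.im ^ 2 := by rw [← hN, Ni_eq]
  have hq1 : ¬ (q : ℤ) ∣ θ.re := by
    intro h
    have h0 : θ.re ≠ 0 := by rintro h0; rw [h0] at hre; simp at hre
    have h2 := Int.natAbs_le_of_dvd_ne_zero h h0
    rw [Int.natAbs_natCast] at h2
    have h3 : (q : ℤ) ≤ |θ.re| := by rw [Int.abs_eq_natAbs]; exact_mod_cast h2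
    have h5 : |θ.re| ^ 2 = θ.re ^ 2 := sq_abs _
    have h6 : (2 : ℤ) ≤ q := by exact_mod_cast hq.two_le
    nlinarith [sq_nonneg θ.im]
  have hc : ¬ θ ∣ (θ.re : Zi) := not_dvd_intCast_of_prime_norm hθ hq hN hq1
  have hcong : θ ∣ (θ.re : Zi) * α - ((α.re * θ.re + α.im * θ.im : ℤ) : Zi) := by
    refine ⟨(α.im : Zi) * ⟨0, 1⟩, ?_⟩
    ext
    · simp
      ring
    · simp
  have hm : ¬ θ ∣ ((α.re * θ.re + α.im * θ.im : ℤ) : Zi) := fun h =>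
    (hθ.dvd_or_dvd ((dvd_sub_left h).mp hcong)).elim hc hα
  have hjc : J(θ.re | q) = 1 := by
    refine jacobiSym_eq_one_of_sq (n := θ.im) hre (by omega) ⟨θ.re, by rw [hqN]; ring⟩ ?_
    exact ((Nat.prime_iff_prime_int.mp hq).coprime_iff_not_dvd.mpr hq1).symm
  refine ⟨fun h => hm (dvd_intCast_of_dvd hN h), ?_⟩
  have h1 : quadSym ((θ.re : Zi) * α) θ = quadSym α θ := by
    rw [quadSym_mul_left hodd, quadSym_intCast hθ hodd hN hc, jacobiSym.legendreSym.to_jacobiSym,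
      hjc, Int.cast_one, one_mul]
  have h2 : quadSym ((θ.re : Zi) * α) θ =
      quadSym ((α.re * θ.re + α.im * θ.im : ℤ) : Zi) θ := by
    refine quadSym_congr hθ.ne_zero fun p hp hpθ => ?_
    exact hpθ.trans hcong
  rw [← h1, h2, quadSym_intCast hθ hodd hN hm, jacobiSym.legendreSym.to_jacobiSym]

theorem quadSym_comm_split_split {π θ : Zi} (hπ : Prime π) (hθ : Prime θ) (hπo : ¬ lam ∣ π)
    (hθo : ¬ lam ∣ θ) (hπi : Even π.im) (hθi : Even θ.im) (hπθ : ¬ π ∣ θ) (hθπ : ¬ θ ∣ π)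
    {p q : ℕ} (hp : p.Prime) (hq : q.Prime) (hpN : Ni π = p) (hqN : Ni θ = q) :
    quadSym π θ = quadSym θ π := by
  obtain ⟨h1, h2⟩ := quadSym_split hθ hθo hθi hq hqN hθπ
  obtain ⟨h3, h4⟩ := quadSym_split hπ hπo hπi hp hpN hπθ
  rw [h2, h4]
  rw [mul_comm θ.re, mul_comm θ.im] at h3 ⊢
  set m := π.re * θ.re + π.im * θ.im with hm
  have hp4 := Ni_mod_four hπo
  have hq4 := Ni_mod_four hθo
  have hcp : IsCoprime m p :=
    ((Nat.prime_iff_prime_int.mp hp).coprime_iff_not_dvd.mpr h3).symm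
  have hcq : IsCoprime m q :=
    ((Nat.prime_iff_prime_int.mp hq).coprime_iff_not_dvd.mpr h1).symm
  have hmo : Odd m := ((odd_re_of_even_im hπo hπi).mul (odd_re_of_even_im hθo hθi)).add_even
    (hπi.mul_right _)
  have key : J(m | p * q) = 1 := by
    refine jacobiSym_eq_one_of_sq (n := π.re * θ.im - π.im * θ.re) hmo ?_ ⟨m, ?_⟩ ?_
    · rw [Nat.mul_mod, show p % 4 = 1 by omega, show q % 4 = 1 by omega]
    · push_cast
      rw [← hpN, ← hqN, Ni_eq, Ni_eq, hm]
      ring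
    · push_cast
      exact hcp.mul_right hcq
  rw [jacobiSym.mul_right' m hp.ne_zero hq.ne_zero] at key
  have hsq := jacobiSym.sq_one (a := m) (b := q) (by simpa [Int.isCoprime_iff_gcd_eq_one] using hcq)
  have : J(m | q) = J(m | p) := by
    linear_combination J(m | p) * hsq - J(m | q) * key
  rw [this]

theorem isUnit_cases {u : Zi} (hu : IsUnit u) :
    u = 1 ∨ u = -1 ∨ u = ⟨0, 1⟩ ∨ u = ⟨0, -1⟩ := by
  have h : Ni u = 1 := (Zsqrtd.norm_eq_one_iff' (by norm_num) u).mpr hu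
  rw [Ni_eq] at h
  obtain ⟨x, y⟩ := u
  simp only at h
  have h1 : x ≤ 1 := by nlinarith
  have h2 : -1 ≤ x := by nlinarith
  have h3 : y ≤ 1 := by nlinarith
  have h4 : -1 ≤ y := by nlinarith
  interval_cases x <;> interval_cases y <;> first | (norm_num at h; done) | decide

theorem eq_or_eq_neg_of_associated_natCast {θ : Zi} {q : ℕ} (hass : Associated θ (q : Zi))
    (hodd : ¬ lam ∣ θ) (him : Even θ.im) : ∃ n : ℤ, θ = n ∧ n.natAbs = q := by
  obtain ⟨u, hu⟩ := hass.symm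
  have hre := odd_re_of_even_im hodd him
  rcases isUnit_cases u.isUnit with h | h | h | h <;> rw [h] at hu
  · exact ⟨q, by rw [← hu]; simp, by simp⟩
  · exact ⟨-q, by rw [← hu]; simp, by simp⟩
  · rw [← hu] at hre; simp at hre
  · rw [← hu] at hre; simp at hre

theorem quadSym_comm_split_inert {π θ : Zi} (hπ : Prime π) (hθ : Prime θ) (hπo : ¬ lam ∣ π)
    (hθo : ¬ lam ∣ θ) (hθi : Even θ.im) (hπθ : ¬ π ∣ θ) (hθπ : ¬ θ ∣ π)
    {p q : ℕ} (hp : p.Prime) (hq : q.Prime) (hpN : Ni π = p) (hq3 : q % 4 = 3)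
    (hass : Associated θ (q : Zi)) : quadSym π θ = quadSym θ π := by
  have := Fact.mk hp
  have := Fact.mk hq
  obtain ⟨n, rfl, hn⟩ := eq_or_eq_neg_of_associated_natCast hass hθo hθi
  have hno : Odd n := by rw [← Int.natAbs_odd, hn, Nat.odd_iff]; omega
  have hp4 := Ni_mod_four hπo
  rw [quadSym_inert hθ hθo hq3 hass hθπ, quadSym_intCast hπ hπo hpN hπθ,
    jacobiSym.legendreSym.to_jacobiSym, jacobiSym.legendreSym.to_jacobiSym,
    jacobiSym_comm_of_one_mod_four hno (by omega), hn, hpN]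

theorem quadSym_inert_inert {π θ : Zi} (hθ : Prime θ) (hθo : ¬ lam ∣ θ) (hθπ : ¬ θ ∣ π)
    {p q : ℕ} (hq : q.Prime) (hq3 : q % 4 = 3) (hass : Associated θ (q : Zi))
    (hass' : Associated π (p : Zi)) : quadSym π θ = 1 := by
  have := Fact.mk hq
  have hN : Ni π = (p : ℤ) ^ 2 := by rw [Ni_associated hass', Ni, Zsqrtd.norm_natCast, sq]
  rw [quadSym_inert hθ hθo hq3 hass hθπ, hN, legendreSym.sq_one', Int.cast_one]
  intro h
  rw [Int.cast_natCast, ZMod.natCast_eq_zero_iff] at h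
  exact hθπ (hass.dvd.trans ((Nat.cast_dvd_cast h).trans hass'.symm.dvd))

/-- Quadratic reciprocity for Gaussian primes with even imaginary part. -/
theorem quadSym_comm_prime {π θ : Zi} (hπ : Prime π) (hθ : Prime θ) (hπo : ¬ lam ∣ π)
    (hθo : ¬ lam ∣ θ) (hπi : Even π.im) (hθi : Even θ.im) (hπθ : ¬ π ∣ θ) :
    quadSym π θ = quadSym θ π := by
  have hθπ : ¬ θ ∣ π := fun h => hπθ (hθ.associated_of_dvd hπ h).symm.dvd
  rcases prime_norm_or_inert hπ with ⟨p, hp, hpN⟩ | ⟨p, hp, hp3, hpa⟩ <;>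
  rcases prime_norm_or_inert hθ with ⟨q, hq, hqN⟩ | ⟨q, hq, hq3, hqa⟩
  · exact quadSym_comm_split_split hπ hθ hπo hθo hπi hθi hπθ hθπ hp hq hpN hqN
  · exact quadSym_comm_split_inert hπ hθ hπo hθo hθi hπθ hθπ hp hq hpN hq3 hqa
  · exact (quadSym_comm_split_inert hθ hπ hθo hπo hπi hθπ hπθ hq hp hqN hp3 hpa).symm
  · rw [quadSym_inert_inert hθ hθo hθπ hq hq3 hqa hpa,
      quadSym_inert_inert hπ hπo hπθ hp hp3 hpa hqa]

theorem exists_isUnit_mul_even_im {c : Zi} (hc : ¬ lam ∣ c) :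
    ∃ u : Zi, IsUnit u ∧ Even (u * c).im := by
  rcases Int.even_or_odd c.im with h | h
  · exact ⟨1, isUnit_one, by rwa [one_mul]⟩
  · refine ⟨⟨0, 1⟩, IsUnit.of_mul_eq_one ⟨0, -1⟩ (by decide), ?_⟩
    rw [lam_dvd_iff, Int.not_even_iff_odd] at hc
    simpa using hc.sub_odd h

theorem quarticSym_one_left {c : Zi} (hc : ¬ lam ∣ c) : quarticSym 1 c = 1 := by
  have h1 := quarticSym_mul_left hc 1 1
  have h2 := quadSym_sq hc isCoprime_one_left
  rw [mul_one] at h1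
  rw [quadSym] at h2
  linear_combination (quarticSym 1 c ^ 2 + quarticSym 1 c + 1) * h1 + h2

theorem quadSym_one_left {c : Zi} (hc : ¬ lam ∣ c) : quadSym 1 c = 1 := by
  rw [quadSym, quarticSym_one_left hc, one_pow]

theorem quadSym_neg_one_left {c : Zi} (hc : ¬ lam ∣ c) : quadSym (-1) c = 1 := by
  rw [quadSym, sq, ← quarticSym_mul_left hc, neg_one_mul, neg_neg, quarticSym_one_left hc]

/-- Quadratic reciprocity in `ℤ[i]` with one argument prime. -/
theorem quadSym_comm {π c : Zi} (hπ : Prime π) (hπo : ¬ lam ∣ π) (hπi : Even π.im)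
    (hc : ¬ lam ∣ c) (hci : Even c.im) (hπc : ¬ π ∣ c) : quadSym π c = quadSym c π := by
  suffices h : ∀ u : Zi, IsUnit u → Even (u * c).im → quadSym π (u * c) = quadSym (u * c) π by
    simpa using h 1 isUnit_one (by simpa using hci)
  clear hci
  induction c using UniqueFactorizationMonoid.induction_on_prime with
  | h₁ => exact absurd (dvd_zero _) hc
  | h₂ x hx =>
    intro u hu him
    have hux := hu.mul hx
    rw [quadSym, quarticSym_isUnit_right hux, one_pow]
    rcases isUnit_cases hux with h | h | h | h <;> rw [h] at him ⊢
    · rw [quadSym_one_left hπo]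
    · rw [quadSym_neg_one_left hπo]
    · simp at him
    · simp at him
  | h₃ a p ha hp ih =>
    intro u hu him
    have hpo : ¬ lam ∣ p := fun h => hc (h.mul_right a)
    have hao : ¬ lam ∣ a := fun h => hc (h.mul_left p)
    obtain ⟨w, hw, hwi⟩ := exists_isUnit_mul_even_im hpo
    obtain ⟨w', hww⟩ := hw.exists_right_inv
    have hw' : IsUnit w' := IsUnit.of_mul_eq_one w (by rw [mul_comm, hww])
    have hsplit : u * (p * a) = (w * p) * ((w' * u) * a) := by
      linear_combination (-(u * p * a)) * hww
    have hodd : ¬ lam ∣ w * p := by rwa [hw.dvd_mul_left]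
    have hre := odd_re_of_even_im hodd hwi
    have hai : Even ((w' * u) * a).im := by
      rw [hsplit] at him
      generalize w * p = x at him hre hwi
      generalize w' * u * a = y at him ⊢
      rw [Zsqrtd.im_mul] at him
      have h1 : Even (x.im * y.re) := hwi.mul_right _
      have h2 : Even (x.re * y.im) := (Int.even_add.mp him).mpr h1
      exact (Int.even_mul.mp h2).resolve_left (Int.not_even_iff_odd.mpr hre)
    have hwp : Prime (w * p) := ((associated_unit_mul_right p w hw).prime hp)
    have h1 := quadSym_comm_prime hπ hwp hπo hodd hπi hwi
      (fun h => hπc (((hw.dvd_mul_left).mp h).mul_right a))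
    have h2 := ih hao (fun h => hπc (h.mul_left p)) (w' * u) (hw'.mul hu) hai
    rw [hsplit, quadSym_mul_right hwp.ne_zero (mul_ne_zero (hw'.mul hu).ne_zero ha), h1, h2,
      quadSym_mul_left hπo (w * p)]

theorem quarticSym_periodic {c d e : Zi} (hc : c ≠ 0) (h : c ∣ d - e) :
    quarticSym d c = quarticSym e c :=
  quarticSym_congr hc fun _ _ hp => hp.trans h

/-- The summand of the Gauss sum `g₄(m/λ², c)`. -/
def gaussSummand (m c d : Zi) : ℂ :=
  quarticSym d c * eCheck (GaussianInt.toComplex m / GaussianInt.toComplex lam ^ 2 *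
    GaussianInt.toComplex d / GaussianInt.toComplex c)

theorem gaussSummand_periodic (m : Zi) {c : Zi} (hc : c ≠ 0) :
    PeriodicMod c (gaussSummand m c) := fun d e h => by
  rw [gaussSummand, gaussSummand, quarticSym_periodic hc h, eCheck_periodic m hc h]

theorem g4_mul_eq (m π c : Zi) :
    g4 (GaussianInt.toComplex m / GaussianInt.toComplex lam ^ 2 * GaussianInt.toComplex π) c =
      residueSum c (gaussSummand (m * π) c) := by
  rw [g4, residueSum]
  refine finsum_congr fun x => ?_
  rw [gaussSummand, map_mul]
  congr 2
  ring

/-- If `π³ ∣ c` then `g₄(δπ, c) = 0`. -/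
theorem g4_eq_zero_of_cube_dvd {m π c : Zi} (hπ : Prime π) (hm : ¬ π ∣ m) (hc : c ≠ 0)
    (h : π ^ 3 ∣ c) :
    g4 (GaussianInt.toComplex m / GaussianInt.toComplex lam ^ 2 * GaussianInt.toComplex π) c
      = 0 := by
  rw [g4_mul_eq]
  obtain ⟨k, rfl⟩ := h
  obtain ⟨t, ht⟩ := exists_eCheck_ne_one hπ.ne_zero hm
  have hk : k ≠ 0 := right_ne_zero_of_mul hc
  have hπC : GaussianInt.toComplex π ≠ 0 := GaussianInt.toComplex_eq_zero.not.mpr hπ.ne_zero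
  have hkC : GaussianInt.toComplex k ≠ 0 := GaussianInt.toComplex_eq_zero.not.mpr hk
  have hshift := residueSum_affine hc (gaussSummand_periodic (m * π) hc) isCoprime_one_left
    (π * k * t)
  rw [residueSum_congr (G := fun d => eCheck (GaussianInt.toComplex m /
    GaussianInt.toComplex lam ^ 2 * GaussianInt.toComplex t / GaussianInt.toComplex π) *
    gaussSummand (m * π) (π ^ 3 * k) d), residueSum_const_mul] at hshift
  · exact eq_zero_of_mul_eq_self_left ht hshift
  · intro d
    rw [gaussSummand, gaussSummand, mul_left_comm, ← eCheck_add]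
    congr 1
    · refine quarticSym_congr hc fun p hp hpc => ?_
      have : p ∣ π * k := by
        rcases hp.dvd_or_dvd hpc with h | h
        · exact (hp.dvd_of_dvd_pow h).mul_right k
        · exact h.mul_left π
      convert this.mul_right t using 1
      ring
    · congr 1
      simp only [map_mul, map_add, map_pow, map_one]
      field_simp
      ring

theorem exists_quarticPrime_ne_one {π : Zi} (hπ : Prime π) (hodd : ¬ lam ∣ π) :
    ∃ α : Zi, ¬ π ∣ α ∧ quarticPrime α π ≠ 1 := by
  have h4 := Ni_mod_four hodd
  have h1 := norm_ne_one hπ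
  have h0 := Ni_pos hπ.ne_zero
  obtain ⟨α, hα, h⟩ := exists_not_dvd_pow_sub_one hπ (k := ((Ni π - 1) / 4).toNat) (by omega)
    (by omega)
  refine ⟨α, hα, fun h' => h ?_⟩
  rw [← h']
  exact (quarticPrime_spec hπ hodd hα).2

/-- If `π` divides `c` exactly once then `g₄(δπ, c) = 0`. -/
theorem g4_eq_zero_of_exactly_dvd (m : Zi) {π c : Zi} (hπ : Prime π) (hc : ¬ lam ∣ c * π)
    (h : ¬ π ∣ c) :
    g4 (GaussianInt.toComplex m / GaussianInt.toComplex lam ^ 2 * GaussianInt.toComplex π)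
      (c * π) = 0 := by
  rw [g4_mul_eq]
  have hc0 : c * π ≠ 0 := ne_zero_of_not_lam_dvd hc
  have hc1 : c ≠ 0 := left_ne_zero_of_mul hc0
  have hπo : ¬ lam ∣ π := fun h => hc (h.mul_left c)
  have hπC : GaussianInt.toComplex π ≠ 0 := GaussianInt.toComplex_eq_zero.not.mpr hπ.ne_zero
  have hcC : GaussianInt.toComplex c ≠ 0 := GaussianInt.toComplex_eq_zero.not.mpr hc1
  obtain ⟨α, hα, hne⟩ := exists_quarticPrime_ne_one hπ hπo
  obtain ⟨x, y, hxy⟩ : IsCoprime π c := hπ.coprime_iff_not_dvd.mpr h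
  -- `u ≡ 1 (mod c)` and `u ≡ α (mod π)`
  obtain ⟨u, ⟨v, hv⟩, huπ⟩ : ∃ u, c ∣ u - 1 ∧ π ∣ u - α :=
    ⟨1 + (α - 1) * (y * c), ⟨(α - 1) * y, by ring⟩, ⟨(1 - α) * x, by
      linear_combination (α - 1) * hxy⟩⟩
  obtain rfl : u = 1 + c * v := by rw [← hv]; ring
  have huπ' : ¬ π ∣ 1 + c * v := fun h' => hα ((dvd_sub_right h').mp huπ)
  have hucop : IsCoprime (1 + c * v) (c * π) :=
    IsCoprime.mul_right (isCoprime_one_left.add_mul_left_left v)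
      ((isCoprime_prime_iff hπ _).mpr huπ')
  have hsym : quarticSym (1 + c * v) (c * π) = GaussianInt.toComplex (quarticPrime α π) := by
    rw [quarticSym_mul_right hc1 hπ.ne_zero, quarticSym_periodic (d := 1 + c * v) (e := 1) hc1 ⟨v, by ring⟩,
      quarticSym_one_left (fun h => hc (h.mul_right π)), one_mul, quarticSym_prime hπ huπ',
      quarticPrime_congr huπ]
  have hscale := residueSum_affine hc0 (gaussSummand_periodic (m * π) hc0) hucop 0
  rw [residueSum_congr (G := fun d => GaussianInt.toComplex (quarticPrime α π) *
    gaussSummand (m * π) (c * π) d), residueSum_const_mul] at hscale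
  · refine eq_zero_of_mul_eq_self_left (fun h1 => hne ?_) hscale
    rwa [← map_one GaussianInt.toComplex, GaussianInt.toComplex_inj] at h1
  · intro d
    rw [gaussSummand, gaussSummand, add_zero, quarticSym_mul_left hc, hsym, mul_assoc]
    congr 2
    refine Eq.trans ?_ (eCheck_add_lattice _ (m * v * d))
    congr 1
    simp only [map_mul, map_add, map_one]
    field_simp

/-- `g₄(δπ, cπ²) = N(π) g₂(δ, π) g₄(δπ, c)` for `π ∤ c`. -/
theorem g4_mul_sq (m : Zi) {π c : Zi} (hπ : Prime π) (hπi : Even π.im) (hci : Even c.im)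
    (hπo : ¬ lam ∣ π) (hc : ¬ lam ∣ c) (h : ¬ π ∣ c) :
    g4 (GaussianInt.toComplex m / GaussianInt.toComplex lam ^ 2 * GaussianInt.toComplex π)
      (c * π ^ 2) = Ni π * g2 (GaussianInt.toComplex m / GaussianInt.toComplex lam ^ 2) π *
        g4 (GaussianInt.toComplex m / GaussianInt.toComplex lam ^ 2 * GaussianInt.toComplex π)
          c := by
  have hπ0 := hπ.ne_zero
  have hc0 := ne_zero_of_not_lam_dvd hc
  have hπC : GaussianInt.toComplex π ≠ 0 := GaussianInt.toComplex_eq_zero.not.mpr hπ0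
  have hcC : GaussianInt.toComplex c ≠ 0 := GaussianInt.toComplex_eq_zero.not.mpr hc0
  have hcπ : c * π ≠ 0 := mul_ne_zero hc0 hπ0
  have hcop : IsCoprime π c := hπ.coprime_iff_not_dvd.mpr h
  set F := gaussSummand (m * π) (c * π ^ 2) with hF
  have hFsplit (d : Zi) : F d = quarticSym d c * quadSym d π *
      eCheck (GaussianInt.toComplex m / GaussianInt.toComplex lam ^ 2 *
        GaussianInt.toComplex d / GaussianInt.toComplex (c * π)) := by
    rw [hF, gaussSummand, quarticSym_mul_right hc0 (pow_ne_zero 2 hπ0), sq,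
      quarticSym_mul_right hπ0 hπ0, quadSym, sq (quarticSym d π)]
    congr 2
    simp only [map_mul]
    field_simp
  have hFper : PeriodicMod (c * π) F := fun d e hde => by
    rw [hFsplit, hFsplit, eCheck_periodic m hcπ hde,
      quarticSym_periodic hc0 (dvd_of_mul_right_dvd hde), quadSym, quadSym,
      quarticSym_periodic hπ0 (dvd_of_mul_left_dvd hde)]
  have hrec : quadSym π c * quadSym c π = 1 := by
    rw [← quadSym_comm hπ hπo hπi hc hci h, ← sq, quadSym_sq hc hcop]
  have hcrt (x y : Zi) : F (π ^ 2 * x + c * y) = gaussSummand (m * π) c x * (quadSym y π *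
      eCheck (GaussianInt.toComplex m / GaussianInt.toComplex lam ^ 2 *
        GaussianInt.toComplex y / GaussianInt.toComplex π)) := by
    have e1 : quarticSym (π ^ 2 * x + c * y) c = quadSym π c * quarticSym x c := by
      rw [quarticSym_periodic (d := π ^ 2 * x + c * y) (e := π ^ 2 * x) hc0 ⟨y, by ring⟩,
        quarticSym_mul_left hc, sq, quarticSym_mul_left hc, quadSym, sq]
    have e2 : quadSym (π ^ 2 * x + c * y) π = quadSym c π * quadSym y π := by
      rw [quadSym, quarticSym_periodic (d := π ^ 2 * x + c * y) (e := c * y) hπ0 ⟨π * x, by ring⟩,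
        ← quadSym, quadSym_mul_left hπo]
    have e3 : GaussianInt.toComplex m / GaussianInt.toComplex lam ^ 2 *
        GaussianInt.toComplex (π ^ 2 * x + c * y) / GaussianInt.toComplex (c * π) =
        GaussianInt.toComplex (m * π) / GaussianInt.toComplex lam ^ 2 *
          GaussianInt.toComplex x / GaussianInt.toComplex c +
        GaussianInt.toComplex m / GaussianInt.toComplex lam ^ 2 *
          GaussianInt.toComplex y / GaussianInt.toComplex π := by
      simp only [map_mul, map_add, map_pow]
      field_simp
    rw [hFsplit, e1, e2, e3, eCheck_add, gaussSummand]
    linear_combination (quarticSym x c * quadSym y π *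
      eCheck (GaussianInt.toComplex (m * π) / GaussianInt.toComplex lam ^ 2 *
        GaussianInt.toComplex x / GaussianInt.toComplex c) *
      eCheck (GaussianInt.toComplex m / GaussianInt.toComplex lam ^ 2 *
        GaussianInt.toComplex y / GaussianInt.toComplex π)) * hrec
  have hlift : residueSum (c * π ^ 2) F = Ni π * residueSum (c * π) F := by
    have hper : PeriodicMod (c * π * π) F := fun d e hde =>
      hFper d e (dvd_of_mul_right_dvd hde)
    rw [show c * π ^ 2 = c * π * π by ring,
      residueSum_mul hcπ hπ0 isCoprime_one_left hper, ← residueSum_const_mul]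
    refine residueSum_congr fun x => ?_
    rw [← residueSum_const hπ0]
    refine residueSum_congr fun y => hFper _ _ ⟨y, by ring⟩
  rw [g4_mul_eq, g4_mul_eq, hlift, residueSum_mul hc0 hπ0 hcop.pow_left hFper, mul_assoc]
  congr 1
  change _ = residueSum π (fun y => quadSym y π *
      eCheck (GaussianInt.toComplex m / GaussianInt.toComplex lam ^ 2 *
        GaussianInt.toComplex y / GaussianInt.toComplex π)) * _
  rw [← residueSum_const_mul]
  refine residueSum_congr fun x => ?_
  rw [residueSum_congr (hcrt x), residueSum_const_mul, mul_comm]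

theorem two_dvd_sub_one {x : Zi} (h : lam ^ 3 ∣ x - 1) : (2 : Zi) ∣ x - 1 :=
  (show (2 : Zi) ∣ lam ^ 3 from ⟨⟨-1, 1⟩, by decide⟩).trans h

theorem four_dvd_sq_sub_one {x : Zi} (h : lam ^ 3 ∣ x - 1) : (4 : Zi) ∣ x ^ 2 - 1 := by
  obtain ⟨t, ht⟩ := h
  obtain rfl : x = 1 + lam ^ 3 * t := by rw [← ht]; ring
  have h1 : lam ^ 3 * 2 = 4 * ⟨-1, 1⟩ := by decide
  have h2 : lam ^ 6 = 4 * ⟨0, -2⟩ := by decide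
  exact ⟨⟨-1, 1⟩ * t + ⟨0, -2⟩ * t ^ 2, by linear_combination t * h1 + t ^ 2 * h2⟩

theorem odd_and_even_im_of_two_dvd {x : Zi} (h : (2 : Zi) ∣ x - 1) :
    ¬ lam ∣ x ∧ Even x.im := by
  obtain ⟨t, ht⟩ := h
  obtain rfl : x = 1 + 2 * t := by rw [← ht]; ring
  rw [lam_dvd_iff, Int.not_even_iff_odd]
  exact ⟨⟨t.re + t.im, by simp; ring⟩, ⟨t.im, by simp; ring⟩⟩

theorem Ni_cpow_mul_sq (c : Zi) {π : Zi} (hπ : π ≠ 0) (s : ℂ) :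
    ((Ni (c * π ^ 2) : ℤ) : ℂ) ^ s = (Ni c : ℂ) ^ s * (Ni π : ℂ) ^ (2 * s) := by
  have h : Ni (c * π ^ 2) = Ni c * (Ni π * Ni π) := by
    simp only [Ni, sq, Zsqrtd.norm_mul]
  have hc : (0 : ℝ) ≤ (Ni c : ℝ) := by exact_mod_cast GaussianInt.norm_nonneg c
  have hp : (0 : ℝ) ≤ (Ni π : ℝ) := by exact_mod_cast GaussianInt.norm_nonneg π
  have hp0 : (Ni π : ℂ) ≠ 0 := by exact_mod_cast (Ni_pos hπ).ne'
  rw [h]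
  have e (n : ℤ) : (n : ℂ) = ((n : ℝ) : ℂ) := by push_cast; rfl
  rw [Int.cast_mul, Int.cast_mul, e (Ni c), e (Ni π), ← Complex.ofReal_mul,
    Complex.mul_cpow_ofReal_nonneg hc (mul_nonneg hp hp), Complex.ofReal_mul,
    Complex.mul_cpow_ofReal_nonneg hp hp, two_mul, Complex.cpow_add _ _ (by rwa [← e])]

/-- If `f` agrees with `A` off the multiples of `π`, where `A` is supported, and `f` is otherwise
`K` times the push-forward of `A` along `c ↦ c π²`, then the sums differ by the factor `1 + K`.
No convergence is needed: neither series converges unless both do. -/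
theorem tsum_eq_one_add_mul_tsum {π : Zi} (hπ : π ≠ 0) {f A : Zi → ℂ} {K : ℂ}
    (hA : ∀ c, π ∣ c → A c = 0) (hfA : ∀ c, ¬ π ∣ c → f c = A c)
    (hsq : ∀ c, f (c * π ^ 2) = K * A c) (hf : ∀ c, π ∣ c → ¬ π ^ 2 ∣ c → f c = 0) :
    ∑' c, f c = (1 + K) * ∑' c, A c := by
  by_cases hs : Summable A
  · have hinj : Function.Injective fun c : Zi => c * π ^ 2 :=
      mul_left_injective₀ (pow_ne_zero 2 hπ)
    have hB0 (c : Zi) (hc : c ∉ Set.range fun c : Zi => c * π ^ 2) : f c - A c = 0 := by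
      have hc' : ¬ π ^ 2 ∣ c := fun ⟨k, hk⟩ => hc ⟨k, by rw [hk, mul_comm]⟩
      by_cases h : π ∣ c
      · rw [hf c h hc', hA c h, sub_zero]
      · rw [hfA c h, sub_self]
    have hcomp : (fun c => f c - A c) ∘ (fun c => c * π ^ 2) = fun c => K * A c := by
      funext c
      simp only [Function.comp]
      rw [hsq, hA _ ((dvd_pow_self π two_ne_zero).mul_left c), sub_zero]
    have hBs : Summable fun c => f c - A c := by
      rw [← hinj.summable_iff hB0, hcomp]
      exact hs.mul_left K
    have hBt : ∑' c, (f c - A c) = K * ∑' c, A c := by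
      rw [← tsum_mul_left, ← hinj.tsum_eq (f := fun c => f c - A c)]
      · exact tsum_congr fun c => congrFun hcomp c
      · exact fun c hc => by_contra fun h => hc (hB0 c h)
    calc ∑' c, f c = ∑' c, (A c + (f c - A c)) := by simp
      _ = (1 + K) * ∑' c, A c := by rw [hs.tsum_add hBs, hBt]; ring
  · have hAi : A = Set.indicator {c | ¬ π ∣ c} f := by
      funext c
      by_cases hc : π ∣ c
      · rw [hA c hc, Set.indicator_of_notMem (by simpa using hc)]
      · rw [← hfA c hc, Set.indicator_of_mem (by simpa using hc)]
    have hfs : ¬ Summable f := fun h => hs (by rw [hAi]; exact h.indicator _)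
    rw [tsum_eq_zero_of_not_summable hs, tsum_eq_zero_of_not_summable hfs, mul_zero]

/-- Euler-type factor extraction for `ψ` at `δπ`. -/
theorem psi_coprimality_linear (γ π : Zi) (hγ : lam ^ 3 ∣ γ - 1) (hπc : lam ^ 3 ∣ π - 1)
    (hπ : Prime π) (hnd : ¬ π ∣ γ)
    (δ : ℂ) (hδ : ∃ m : Zi, δ = GaussianInt.toComplex m / GaussianInt.toComplex lam ^ 2 ∧
      IsCoprime m π)
    (v : Zi) (hv : lam ^ 3 ∣ v - 1) (s : ℂ) (hs : 3 / 2 < s.re) :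
    psiA γ (δ * GaussianInt.toComplex π) s v =
      (1 + g2 δ π * (Ni π : ℂ) ^ ((1 : ℂ) - 2 * s)) *
        psiA (γ * π) (δ * GaussianInt.toComplex π) s v := by
  obtain ⟨m, rfl, hm⟩ := hδ
  have hm' : ¬ π ∣ m := (isCoprime_prime_iff hπ m).mp hm
  have hπγ : IsCoprime π γ := hπ.coprime_iff_not_dvd.mpr hnd
  obtain ⟨hπo, hπi⟩ := odd_and_even_im_of_two_dvd (two_dvd_sub_one hπc)
  have hcong {c : Zi} (hc : (4 : Zi) ∣ c - v) : ¬ lam ∣ c ∧ Even c.im := by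
    apply odd_and_even_im_of_two_dvd
    have := ((show (2 : Zi) ∣ 4 from ⟨2, by norm_num⟩).trans hc).add (two_dvd_sub_one hv)
    rwa [sub_add_sub_cancel] at this
  rw [psiA, psiA]
  refine tsum_eq_one_add_mul_tsum hπ.ne_zero (fun c hc => ?_) (fun c hc => ?_) (fun c => ?_)
    (fun c hc hc2 => ?_)
  · exact if_neg fun h => not_dvd_of_isCoprime hπ h.2 (dvd_mul_left π γ) hc
  · have : IsCoprime c (γ * π) ↔ IsCoprime c γ := by
      rw [IsCoprime.mul_right_iff, isCoprime_prime_iff hπ, and_iff_left hc]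
    rw [this]
  · have h4 : (4 : Zi) ∣ c * π ^ 2 - v ↔ (4 : Zi) ∣ c - v := by
      rw [← dvd_add_right ((four_dvd_sq_sub_one hπc).mul_left c) (c := c - v)]
      ring_nf
    have hcop : IsCoprime (c * π ^ 2) γ ↔ IsCoprime c γ := by
      rw [IsCoprime.mul_left_iff, and_iff_left hπγ.pow_left]
    rw [h4, hcop, IsCoprime.mul_right_iff, isCoprime_prime_iff hπ]
    by_cases h : (4 : Zi) ∣ c - v ∧ IsCoprime c γ
    · obtain ⟨hco, hci⟩ := hcong h.1
      rw [if_pos h]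
      by_cases hπd : π ∣ c
      · rw [if_neg (fun h' => h'.2.2 hπd), mul_zero, g4_eq_zero_of_cube_dvd hπ hm'
          (mul_ne_zero (ne_zero_of_not_lam_dvd hco) (pow_ne_zero 2 hπ.ne_zero)), zero_div]
        rw [pow_succ']
        exact mul_dvd_mul_right hπd _
      · rw [if_pos ⟨h.1, h.2, hπd⟩, g4_mul_sq m hπ hπi hci hπo hco hπd,
          Ni_cpow_mul_sq c hπ.ne_zero,
          Complex.cpow_sub _ _ (by exact_mod_cast (Ni_pos hπ.ne_zero).ne'), Complex.cpow_one]
        ring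
    · rw [if_neg h, if_neg (fun h' => h ⟨h'.1, h'.2.1⟩), mul_zero]
  · split_ifs with h
    · obtain ⟨k, rfl⟩ := hc
      rw [mul_comm π k] at h ⊢
      have hk : ¬ π ∣ k := fun hk => hc2 (by rw [sq]; exact mul_dvd_mul_left π hk)
      rw [g4_eq_zero_of_exactly_dvd m hπ (hcong h.1).1 hk, zero_div]
    · rfl
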